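/- Let M ∈ F_2^{m×n} and b,b′ ∈ F_2^m, and let u be a magic unitary over a unital C*-algebra with rows indexed by V(G(M,b)) and columns indexed by V(G(M,b′)) satisfying the isomorphism relations. Then: (i) u_{(l,α),(k,β)} = 0 whenever l ≠ k; (ii) for each k ∈ [m] and all α,α′ ∈ ±1^{S_k}_{b_k}, β,β′ ∈ ±1^{S_k}_{b′_k} with α△β = α′△β′, one has u_{(k,α),(k,β)} = u_{(k,α′),(k,β′)} (note α△β ∈ ±1^{S_k}_{b_k+b′_k}); (iii) for each fixed k, the elements u_{(k,α),(k,β)} pairwise commute. -/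

import Mathlib

open scoped BigOperators

/-- A magic unitary over a ring with star: every entry is a projection and
every row and column sums to `1`. -/
def IsMagicUnitary {I J A : Type*} [Fintype I] [Fintype J] [Ring A] [StarRing A]
    (u : I → J → A) : Prop :=
  (∀ i j, star (u i j) = u i j) ∧ (∀ i j, u i j * u i j = u i j) ∧
    (∀ i, ∑ j, u i j = 1) ∧ (∀ j, ∑ i, u i j = 1)

/-- The sign `(-1)^x` for `x ∈ F₂`. -/
def signZ (x : ZMod 2) : ℤˣ := if x = 0 then 1 else -1

/-- `S_k = {i : M k i = 1}`. -/
def Sk {m n : ℕ} (M : Matrix (Fin m) (Fin n) (ZMod 2)) (k : Fin m) : Finset (Fin n) :=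
  Finset.univ.filter fun i => M k i = 1

/-- The vertex set of the colored graph `G(M,b)`: pairs `(k, α)` where
`α : ±1^{S_k}` with `∏_{i ∈ S_k} α i = (-1)^{b k}`, encoded as functions on `Fin n`
normalized to `1` off `S_k`. -/
abbrev GVertex {m n : ℕ} (M : Matrix (Fin m) (Fin n) (ZMod 2)) (b : Fin m → ZMod 2) : Type :=
  {p : Fin m × (Fin n → ℤˣ) //
    (∀ i, i ∉ Sk M p.1 → p.2 i = 1) ∧ ∏ i ∈ Sk M p.1, p.2 i = signZ (b p.1)}

/-- `v` and `w` are joined by an edge of color `({l,k}, δ|_{S_l ∩ S_k})` in `G(M,b)`. -/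
def adjC {m n : ℕ} (M : Matrix (Fin m) (Fin n) (ZMod 2)) (b : Fin m → ZMod 2)
    (l k : Fin m) (δ : Fin n → ℤˣ) (v w : GVertex M b) : Prop :=
  ((v.1.1 = l ∧ w.1.1 = k) ∨ (v.1.1 = k ∧ w.1.1 = l)) ∧ v ≠ w ∧
    (Sk M l ∩ Sk M k).Nonempty ∧
    ∀ i ∈ Sk M l ∩ Sk M k, v.1.2 i * w.1.2 i = δ i

open Classical in
/-- The 0/1 adjacency matrix (with entries in `A`) of the color class
`({l,k}, δ|_{S_l ∩ S_k})` of the colored graph `G(M,b)`. -/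
noncomputable def adjMat (A : Type*) [Zero A] [One A] {m n : ℕ}
    (M : Matrix (Fin m) (Fin n) (ZMod 2)) (b : Fin m → ZMod 2)
    (l k : Fin m) (δ : Fin n → ℤˣ) (v w : GVertex M b) : A :=
  if adjC M b l k δ v w then 1 else 0

/-- `u` satisfies the `Qut(G(M,b))` relations: entries vanish between distinct
vertex colors, and `u` commutes with every edge-color adjacency matrix. -/
def QutRel (A : Type*) [Ring A] {m n : ℕ} (M : Matrix (Fin m) (Fin n) (ZMod 2))
    (b : Fin m → ZMod 2) (u : GVertex M b → GVertex M b → A) : Prop :=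
  (∀ v w : GVertex M b, v.1.1 ≠ w.1.1 → u v w = 0) ∧
  ∀ (l k : Fin m) (δ : Fin n → ℤˣ) (v w : GVertex M b),
    ∑ x, adjMat A M b l k δ v x * u x w = ∑ x, u v x * adjMat A M b l k δ x w

/-- `u` (rows indexed by `V(G(M,b))`, columns by `V(G(M,b'))`) satisfies the
isomorphism relations: entries vanish between distinct vertex colors and
`A_c u = u A'_c` for every edge color `c`. -/
def IsoRel (A : Type*) [Ring A] {m n : ℕ} (M : Matrix (Fin m) (Fin n) (ZMod 2))
    (b b' : Fin m → ZMod 2) (u : GVertex M b → GVertex M b' → A) : Prop :=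
  (∀ (v : GVertex M b) (w : GVertex M b'), v.1.1 ≠ w.1.1 → u v w = 0) ∧
  ∀ (l k : Fin m) (δ : Fin n → ℤˣ) (v : GVertex M b) (w : GVertex M b'),
    ∑ x, adjMat A M b l k δ v x * u x w = ∑ y, u v y * adjMat A M b' l k δ y w

section CStarRing

variable {A : Type*} [NormedRing A] [StarRing A] [CStarRing A]

/-- A self-adjoint element whose powers are uniformly bounded is a contraction. -/
theorem IsSelfAdjoint.norm_le_one_of_norm_pow_le {z : A} (hz : IsSelfAdjoint z) {C : ℝ}
    (h : ∀ n : ℕ, n ≠ 0 → ‖z ^ n‖ ≤ C) : ‖z‖ ≤ 1 := by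
  by_contra! hlt
  obtain ⟨n, hn⟩ := pow_unbounded_of_one_lt C hlt
  have h₁ : ‖z ^ 2 ^ n‖ = ‖z‖ ^ 2 ^ n := by
    simpa using congrArg NNReal.toReal (hz.nnnorm_pow_two_pow n)
  have h₂ : ‖z‖ ^ n ≤ ‖z‖ ^ 2 ^ n := pow_le_pow_right₀ hlt.le Nat.lt_two_pow_self.le
  have h₃ := h (2 ^ n) (by positivity)
  linarith

theorem IsStarProjection.norm_le_one {p : A} (hp : IsStarProjection p) : ‖p‖ ≤ 1 := by
  refine hp.isSelfAdjoint.norm_le_one_of_norm_pow_le (C := ‖p‖) fun n hn => ?_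
  rw [hp.isIdempotentElem.pow_eq hn]

/-- The reflection through a projection, compressed to a second projection and extended by
the identity, is a contraction. -/
theorem IsStarProjection.norm_one_sub_two_mul_compression_le_one [Nontrivial A] {p q : A}
    (hp : IsStarProjection p) (hq : IsStarProjection q) :
    ‖1 - 2 * (p * q * p)‖ ≤ 1 := by
  have hpp : p * p = p := hp.isIdempotentElem
  have hqq : q * q = q := hq.isIdempotentElem
  have hps : star p = p := hp.isSelfAdjoint
  have hqs : star q = q := hq.isSelfAdjoint
  have hr : ‖(1 - 2 * q : A)‖ ≤ 1 := by
    have hs : star (1 - 2 * q) * (1 - 2 * q) = (1 : A) := by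
      simp only [star_sub, star_one, star_mul, star_ofNat, hqs]
      have : (1 - q * 2) * (1 - 2 * q) = 1 - 4 * q + 4 * (q * q) := by noncomm_ring
      rw [this, hqq]; noncomm_ring
    have := CStarRing.norm_star_mul_self (x := (1 - 2 * q : A))
    rw [hs, norm_one] at this
    nlinarith [norm_nonneg (1 - 2 * q : A)]
  have hp1 := hp.norm_le_one
  have hc : ‖p * (1 - 2 * q) * p‖ ≤ 1 := by
    calc ‖p * (1 - 2 * q) * p‖ ≤ ‖p‖ * ‖1 - 2 * q‖ * ‖p‖ := norm_mul₃_le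
      _ ≤ 1 * 1 * 1 := by gcongr
      _ = 1 := by norm_num
  set c := p * (1 - 2 * q) * p with hcdef
  have hpc : p * c = c := by simp only [hcdef, ← mul_assoc, hpp]
  have hcp : c * p = c := by simp only [hcdef, mul_assoc, hpp]
  have hz : 1 - 2 * (p * q * p) = (1 - p) + c := by
    have : c = p * p - 2 * (p * q * p) := by rw [hcdef]; noncomm_ring
    rw [this, hpp]; abel
  have hpow : ∀ n : ℕ, ((1 - p) + c) ^ (n + 1) = (1 - p) + c ^ (n + 1) := by
    intro n
    induction n with
    | zero => simp
    | succ n ih =>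
      have e₁ : (1 - p) * (1 - p) = 1 - p := by
        simp [mul_sub, sub_mul, hpp]
      have e₂ : (1 - p) * c = 0 := by simp [sub_mul, hpc]
      have e₃ : c ^ (n + 1) * (1 - p) = 0 := by
        rw [pow_succ, mul_assoc, mul_sub, mul_one, hcp, sub_self, mul_zero]
      rw [pow_succ, ih, add_mul, mul_add, mul_add, e₁, e₂, e₃, ← pow_succ]
      abel
  refine IsSelfAdjoint.norm_le_one_of_norm_pow_le (C := 2) ?_ fun n hn => ?_
  · have h2 : star (2 : A) = 2 := star_ofNat 2
    have hcomm : p * q * p * 2 = 2 * (p * q * p) := (Nat.cast_commute 2 (p * q * p)).symm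
    simp only [IsSelfAdjoint, star_sub, star_one, star_mul, hps, hqs, h2, ← mul_assoc]
    rw [hcomm]; simp only [mul_assoc]
  · obtain ⟨n, rfl⟩ := Nat.exists_eq_succ_of_ne_zero hn
    rw [hz, Nat.succ_eq_add_one, hpow]
    have h₁ : ‖1 - p‖ ≤ 1 := hp.one_sub.norm_le_one
    have h₂ : ‖c ^ (n + 1)‖ ≤ 1 := (norm_pow_le c _).trans (pow_le_one₀ (norm_nonneg _) hc)
    linarith [norm_add_le (1 - p) (c ^ (n + 1))]

end CStarRing

section ComplexCStarRing

variable {A : Type*} [NormedRing A] [StarRing A] [CStarRing A] [NormedAlgebra ℂ A]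
  [CompleteSpace A]

/-- A self-adjoint element with spectrum contained in `{0}` vanishes. The involution is not
assumed to be conjugate-linear. -/
theorem IsSelfAdjoint.eq_zero_of_spectrum_subset {y : A} (hy : IsSelfAdjoint y)
    (h : spectrum ℂ y ⊆ {0}) : y = 0 := by
  have hr : spectralRadius ℂ y = 0 := by
    refine le_antisymm (iSup₂_le fun k hk => ?_) bot_le
    rw [Set.mem_singleton_iff.mp (h hk)]; simp
  have hconst : Filter.Tendsto (fun _ : ℕ => (‖y‖₊ : ENNReal)) Filter.atTop _ :=
    tendsto_const_nhds
  have hlim : spectralRadius ℂ y = ‖y‖₊ := by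
    refine tendsto_nhds_unique ?_ hconst
    convert (spectrum.pow_nnnorm_pow_one_div_tendsto_nhds_spectralRadius y).comp
      (tendsto_pow_atTop_atTop_of_one_lt one_lt_two) using 1
    refine funext fun n => ?_
    rw [Function.comp_apply, hy.nnnorm_pow_two_pow, ENNReal.coe_pow, ← ENNReal.rpow_natCast,
      ← ENNReal.rpow_mul]
    simp
  rw [hr] at hlim
  simpa using hlim.symm

/-- If `1 - 2y` and `K + 2y` lie in the balls of radius `1` and `K`, the spectrum of `y` lies
in the intersection of a disc in the right half plane with one in the left half plane. -/
theorem IsSelfAdjoint.eq_zero_of_norm_le [Nontrivial A] {y : A} (hy : IsSelfAdjoint y) (K : ℕ)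
    (h₁ : ‖1 - 2 * y‖ ≤ 1) (h₂ : ‖(K : A) + 2 * y‖ ≤ K) : y = 0 := by
  refine hy.eq_zero_of_spectrum_subset fun k hk => ?_
  have m₁ : 1 - 2 * k ∈ spectrum ℂ (1 - 2 * y) := by
    have := spectrum.subset_polynomial_aeval y
      (1 - Polynomial.C 2 * Polynomial.X : Polynomial ℂ) ⟨k, hk, rfl⟩
    simpa [map_ofNat (algebraMap ℂ A)] using this
  have m₂ : (K : ℂ) + 2 * k ∈ spectrum ℂ ((K : A) + 2 * y) := by
    have := spectrum.subset_polynomial_aeval y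
      ((K : Polynomial ℂ) + Polynomial.C 2 * Polynomial.X : Polynomial ℂ) ⟨k, hk, rfl⟩
    simpa [map_ofNat (algebraMap ℂ A)] using this
  have n₁ := (spectrum.norm_le_norm_of_mem m₁).trans h₁
  have n₂ := (spectrum.norm_le_norm_of_mem m₂).trans h₂
  have s₁ : ‖1 - 2 * k‖ ^ 2 ≤ 1 := by nlinarith [norm_nonneg (1 - 2 * k)]
  have s₂ : ‖(K : ℂ) + 2 * k‖ ^ 2 ≤ (K : ℝ) ^ 2 := by gcongr
  rw [Complex.sq_norm, Complex.normSq_apply] at s₁ s₂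
  simp at s₁ s₂
  have hK : (0 : ℝ) ≤ K := K.cast_nonneg
  have hre : 0 ≤ k.re := by nlinarith [sq_nonneg k.re, sq_nonneg k.im]
  have : k.re ^ 2 + k.im ^ 2 = 0 := by
    nlinarith [sq_nonneg k.re, sq_nonneg k.im, mul_nonneg hK hre]
  refine Complex.ext ?_ ?_
  · simp; nlinarith [sq_nonneg k.re, sq_nonneg k.im]
  · simp; nlinarith [sq_nonneg k.re, sq_nonneg k.im]

/-- Projections with sum `1` are pairwise orthogonal. -/
theorem IsStarProjection.mul_eq_zero_of_sum_eq_one {ι : Type*} [Fintype ι] {p : ι → A}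
    (hp : ∀ i, IsStarProjection (p i)) (hsum : ∑ i, p i = 1) {i j : ι} (hij : i ≠ j) :
    p i * p j = 0 := by
  classical
  cases subsingleton_or_nontrivial A
  · exact Subsingleton.elim _ _
  have hs : ∀ k, star (p k) = p k := fun k => (hp k).isSelfAdjoint
  have hi : ∀ k, p k * p k = p k := fun k => (hp k).isIdempotentElem
  have hcomp : ∑ k ∈ (Finset.univ.erase i).erase j, p i * p k * p i = - (p i * p j * p i) := by
    have h : ∑ k, p i * p k * p i = p i := by
      rw [← Finset.sum_mul, ← Finset.mul_sum, hsum, mul_one, hi]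
    rw [← Finset.add_sum_erase _ _ (Finset.mem_univ i), ← Finset.add_sum_erase _ _
      (Finset.mem_erase.mpr ⟨hij.symm, Finset.mem_univ j⟩), hi, hi, add_eq_left] at h
    exact eq_neg_of_add_eq_zero_right h
  have hzero : p i * p j * p i = 0 := by
    refine IsSelfAdjoint.eq_zero_of_norm_le ?_ ((Finset.univ.erase i).erase j).card
      ((hp i).norm_one_sub_two_mul_compression_le_one (hp j)) ?_
    · simp only [IsSelfAdjoint, star_mul, hs, mul_assoc]
    · have h : ∑ k ∈ (Finset.univ.erase i).erase j, (1 - 2 * (p i * p k * p i)) =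
          (((Finset.univ.erase i).erase j).card : A) + 2 * (p i * p j * p i) := by
        rw [Finset.sum_sub_distrib, ← Finset.mul_sum, hcomp]
        simp
      rw [← h]
      refine (norm_sum_le_of_le _ fun k _ =>
        (hp i).norm_one_sub_two_mul_compression_le_one (hp k)).trans ?_
      simp
  rw [← CStarRing.mul_star_self_eq_zero_iff, star_mul, hs, hs, mul_assoc, ← mul_assoc (p j), hi,
    ← mul_assoc, hzero]

end ComplexCStarRing

section ColoredGraph

variable {m n : ℕ} {M : Matrix (Fin m) (Fin n) (ZMod 2)} {b b' : Fin m → ZMod 2}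

theorem GVertex.ext_of_eqOn {v w : GVertex M b} (hc : v.1.1 = w.1.1)
    (h : ∀ i ∈ Sk M v.1.1, v.1.2 i = w.1.2 i) : v = w := by
  refine Subtype.ext (Prod.ext hc (funext fun i => ?_))
  by_cases hi : i ∈ Sk M v.1.1
  · exact h i hi
  · rw [v.2.1 i hi, w.2.1 i (hc ▸ hi)]

/-- Two distinct vertices of the same color `k` form the edge whose color is their difference,
and the second is determined by the first and that color. -/
theorem adjC_self_iff {v w x : GVertex M b} {δ : Fin n → ℤˣ} (hvw : v ≠ w)
    (hc : v.1.1 = w.1.1) (hδ : ∀ i ∈ Sk M v.1.1, v.1.2 i * w.1.2 i = δ i) :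
    adjC M b v.1.1 v.1.1 δ v x ↔ x = w := by
  constructor
  · rintro ⟨hcol, -, -, hx⟩
    have hxv : x.1.1 = v.1.1 := by tauto
    refine GVertex.ext_of_eqOn (hxv.trans hc) fun i hi => ?_
    rw [hxv] at hi
    exact mul_left_cancel ((hx i (by simpa using hi)).trans (hδ i hi).symm)
  · rintro rfl
    refine ⟨Or.inl ⟨rfl, hc.symm⟩, hvw, ?_, by simpa using hδ⟩
    rw [Finset.inter_self]
    by_contra hne
    rw [Finset.not_nonempty_iff_eq_empty] at hne
    exact hvw (GVertex.ext_of_eqOn hc (by simp [hne]))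

theorem adjC_comm {l : Fin m} {δ : Fin n → ℤˣ} {v w : GVertex M b} :
    adjC M b l l δ v w ↔ adjC M b l l δ w v := by
  simp only [adjC, mul_comm, ne_comm (a := v)]
  tauto

/-- The vertex of color `v.1.1` with sign vector `v △ v' △ w'`. -/
def GVertex.translate (v v' : GVertex M b) (w' : GVertex M b') (hv : v'.1.1 = v.1.1)
    (hw : w'.1.1 = v.1.1) : GVertex M b' :=
  ⟨(v.1.1, fun i => v.1.2 i * v'.1.2 i * w'.1.2 i),
    fun i hi => by
      simp [v.2.1 i hi, v'.2.1 i (hv ▸ hi), w'.2.1 i (hw ▸ hi)],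
    by
      have h₁ := v.2.2
      have h₂ := v'.2.2
      have h₃ := w'.2.2
      rw [hv] at h₂
      rw [hw] at h₃
      simp only [Finset.prod_mul_distrib, h₁, h₂, h₃, Int.units_mul_self, one_mul]⟩

theorem IsoRel.apply_eq_of_diff_eq {A : Type*} [Ring A] {u : GVertex M b → GVertex M b' → A}
    (hiso : IsoRel A M b b' u) {v v' : GVertex M b} {w w' : GVertex M b'}
    (hw : v.1.1 = w.1.1) (hv' : v'.1.1 = v.1.1) (hw' : w'.1.1 = v.1.1)
    (h : ∀ i ∈ Sk M v.1.1, v.1.2 i * w.1.2 i = v'.1.2 i * w'.1.2 i) : u v w = u v' w' := by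
  classical
  have hdiff : ∀ i ∈ Sk M v.1.1, w'.1.2 i * w.1.2 i = v.1.2 i * v'.1.2 i := fun i hi => by
    have := h i hi
    calc w'.1.2 i * w.1.2 i
        = v.1.2 i * (v.1.2 i * w.1.2 i) * w'.1.2 i := by
          rw [← mul_assoc, Int.units_mul_self, one_mul, mul_comm]
      _ = v.1.2 i * v'.1.2 i * (w'.1.2 i * w'.1.2 i) := by rw [this]; simp only [mul_assoc]
      _ = v.1.2 i * v'.1.2 i := by rw [Int.units_mul_self, mul_one]
  have hiff : v = v' ↔ w' = w := by
    constructor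
    · rintro rfl
      refine GVertex.ext_of_eqOn (hw'.trans hw) fun i hi => ?_
      exact (mul_left_cancel (h i (hw' ▸ hi))).symm
    · rintro rfl
      refine GVertex.ext_of_eqOn hv'.symm fun i hi => ?_
      exact mul_right_cancel (h i hi)
  by_cases hvv : v = v'
  · rw [hiff.mp hvv, hvv]
  have hww : w' ≠ w := mt hiff.mpr hvv
  have key := hiso.2 v.1.1 v.1.1 (fun i => v.1.2 i * v'.1.2 i) v w'
  have hL : ∀ x, adjC M b v.1.1 v.1.1 (fun i => v.1.2 i * v'.1.2 i) v x ↔ x = v' := fun x =>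
    adjC_self_iff hvv hv'.symm fun _ _ => rfl
  have hR : ∀ y, adjC M b' v.1.1 v.1.1 (fun i => v.1.2 i * v'.1.2 i) y w' ↔ y = w := fun y => by
    rw [adjC_comm, ← hw']
    exact adjC_self_iff hww (hw'.trans hw) (hw' ▸ hdiff)
  simpa [adjMat, hL, hR] using key.symm

end ColoredGraph

/-- Lemma 6.7 (block structure of a quantum isomorphism between `G(M,b)` and
`G(M,b')`): (i) entries between different blocks vanish; (ii) within the `k`-th block
the entry `u_{(k,α),(k,β)}` only depends on `α △ β ∈ ±1^{S_k}_{b_k + b'_k}`; (iii) the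
entries of each block pairwise commute. -/
theorem qisoDecomp {m n : ℕ} (M : Matrix (Fin m) (Fin n) (ZMod 2))
    (b b' : Fin m → ZMod 2)
    {A : Type*} [NormedRing A] [StarRing A] [CStarRing A] [NormedAlgebra ℂ A]
    [CompleteSpace A]
    (u : GVertex M b → GVertex M b' → A)
    (hmu : IsMagicUnitary u) (hiso : IsoRel A M b b' u) :
    (∀ (v : GVertex M b) (w : GVertex M b'), v.1.1 ≠ w.1.1 → u v w = 0) ∧
    (∀ (v v' : GVertex M b) (w w' : GVertex M b'),
      v.1.1 = w.1.1 → v'.1.1 = v.1.1 → w'.1.1 = v.1.1 →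
      (∀ i ∈ Sk M v.1.1, v.1.2 i * w.1.2 i = v'.1.2 i * w'.1.2 i) →
      u v w = u v' w') ∧
    (∀ (v v' : GVertex M b) (w w' : GVertex M b'),
      v.1.1 = w.1.1 → v'.1.1 = v.1.1 → w'.1.1 = v.1.1 →
      u v w * u v' w' = u v' w' * u v w) := by
  refine ⟨hiso.1, fun v v' w w' hw hv' hw' h => hiso.apply_eq_of_diff_eq hw hv' hw' h,
    fun v v' w w' hw hv' hw' => ?_⟩
  have htrans : u v' w' = u v (v.translate v' w' hv' hw') := by
    refine (hiso.apply_eq_of_diff_eq rfl hv' hw' fun i _ => ?_).symm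
    change v.1.2 i * (v.1.2 i * v'.1.2 i * w'.1.2 i) = _
    simp only [← mul_assoc, Int.units_mul_self, one_mul]
  rw [htrans]
  obtain heq | hne := eq_or_ne w (v.translate v' w' hv' hw')
  · rw [← heq]
  · have hproj : ∀ x, IsStarProjection (u v x) := fun x => ⟨hmu.2.1 v x, hmu.1 v x⟩
    rw [IsStarProjection.mul_eq_zero_of_sum_eq_one hproj (hmu.2.2.1 v) hne,
      IsStarProjection.mul_eq_zero_of_sum_eq_one hproj (hmu.2.2.1 v) hne.symm]
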